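/- Let (y_k)_{k∈ℤ} be a sequence of nonzero real numbers and M > 0 a constant such that |y_k − k| ≤ M·log(2 + |k|) for all k ∈ ℤ, and let ξ(z) = e^{iπz}·(1 − z/y_0)·Π_{k≥1}[(1 − z/y_k)(1 − z/y_{−k})]. Then there exists a constant C > 0 (depending on the sequence) such that |ξ(z)| ≤ exp(C·|z|·log(2 + |z|)) for all z ∈ ℂ. In particular, ξ is an entire function of order at most 1. -/

import Mathlib

open Complex Real

lemma aux_log_le (t : ℝ) (ht : 1 ≤ t) : Real.log (2 + t) ≤ 4 * √t := by
  have h1 : Real.log (√(2 + t)) ≤ √(2 + t) - 1 :=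
    Real.log_le_sub_one_of_pos (Real.sqrt_pos.2 (by linarith))
  rw [Real.log_sqrt (by linarith)] at h1
  have h2 : √(2 + t) ≤ 2 * √t := by
    rw [Real.sqrt_le_left (by positivity), mul_pow, Real.sq_sqrt (by linarith)]
    linarith
  linarith

lemma aux_lower (y : ℤ → ℝ) (hy0 : ∀ k, y k ≠ 0) (M : ℝ) (hM : 0 < M)
    (hbound : ∀ k : ℤ, |y k - k| ≤ M * Real.log (2 + |(k : ℝ)|)) :
    ∃ c : ℝ, 0 < c ∧ ∀ k : ℤ, c * |(k : ℝ)| ≤ |y k| := by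
  obtain ⟨K, hK⟩ := exists_nat_ge (64 * M ^ 2 + 1)
  obtain ⟨k0, -, hk0⟩ := Finset.exists_min_image (Finset.Icc (-(K : ℤ)) K) (fun k => |y k|)
    ⟨0, by simp⟩
  have hm : 0 < |y k0| := abs_pos.2 (hy0 k0)
  refine ⟨min (1 / 2) (|y k0| / (K + 1)), by positivity, fun k => ?_⟩
  by_cases hk : k ∈ Finset.Icc (-(K : ℤ)) K
  · have h1 := hk0 k hk
    have h2 : |(k : ℝ)| ≤ K := by
      rw [Finset.mem_Icc] at hk
      rw [abs_le]
      exact_mod_cast hk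
    calc _ ≤ |y k0| / (K + 1) * (K + 1) := by
          gcongr
          · exact min_le_right _ _
          · linarith
      _ = |y k0| := by field_simp
      _ ≤ _ := h1
  · have h2 : (K : ℝ) ≤ |(k : ℝ)| := by
      have : (K : ℤ) ≤ |k| := by
        rw [Finset.mem_Icc, ← abs_le] at hk
        omega
      exact_mod_cast this
    set t := |(k : ℝ)| with ht
    have ht1 : 1 ≤ t := by nlinarith [sq_nonneg M]
    have h3 := aux_log_le t ht1
    have h4 := hbound k
    have h5 : 8 * M ≤ √t := by
      apply Real.le_sqrt_of_sq_le
      nlinarith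
    have h6 : √t * √t = t := Real.mul_self_sqrt (by linarith)
    have h7 : t ≤ |y k| + |y k - k| := by
      have := abs_sub_abs_le_abs_sub (k : ℝ) (y k)
      rw [abs_sub_comm] at this
      linarith
    have h8 : M * Real.log (2 + t) ≤ M * (4 * √t) := by gcongr
    have h9 : 8 * M * √t ≤ √t * √t := by gcongr
    have h10 : min (1 / 2) (|y k0| / (K + 1)) * t ≤ 1 / 2 * t := by
      gcongr
      exact min_le_left _ _
    linarith

lemma aux_factor (a c t : ℝ) (hc : 0 < c) (ht : 0 < t) (ha : c * t ≤ |a|) (z : ℂ) :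
    ‖1 - z / (a : ℂ)‖ ≤ Real.exp (‖z‖ / (c * t)) := by
  calc ‖1 - z / (a : ℂ)‖ ≤ ‖(1 : ℂ)‖ + ‖z / (a : ℂ)‖ := norm_sub_le _ _
    _ = ‖z‖ / |a| + 1 := by simp [add_comm]
    _ ≤ ‖z‖ / (c * t) + 1 := by gcongr
    _ ≤ _ := Real.add_one_le_exp _

lemma aux_pair (a b c t B : ℝ) (hc : 0 < c) (ht : 0 < t) (ha : c * t ≤ |a|) (hb : c * t ≤ |b|)
    (hab : |a + b| ≤ B) (z : ℂ) :
    ‖(1 - z / (a : ℂ)) * (1 - z / (b : ℂ))‖ ≤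
      Real.exp (B / (c * t) ^ 2 * ‖z‖ + ‖z‖ ^ 2 / (c * t) ^ 2) := by
  have hct : 0 < c * t := by positivity
  have ha0 : (a : ℂ) ≠ 0 := by
    have : a ≠ 0 := abs_pos.1 (by linarith)
    exact_mod_cast this
  have hb0 : (b : ℂ) ≠ 0 := by
    have : b ≠ 0 := abs_pos.1 (by linarith)
    exact_mod_cast this
  have e : (1 - z / (a : ℂ)) * (1 - z / (b : ℂ)) =
      1 - (((a + b : ℝ) : ℂ) / (a * b) * z - z ^ 2 / (a * b)) := by
    push_cast
    field_simp
    ring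
  rw [e]
  have hB : 0 ≤ B := (abs_nonneg _).trans hab
  have hq : (c * t) ^ 2 ≤ |a| * |b| := by
    rw [sq]
    gcongr
  calc _ ≤ ‖(1 : ℂ)‖ + (‖((a + b : ℝ) : ℂ) / (a * b) * z‖ + ‖z ^ 2 / ((a : ℂ) * b)‖) :=
        (norm_sub_le _ _).trans (by gcongr; exact norm_sub_le _ _)
    _ = |a + b| / (|a| * |b|) * ‖z‖ + ‖z‖ ^ 2 / (|a| * |b|) + 1 := by
        rw [norm_mul, norm_div, norm_div, norm_mul, norm_pow, Complex.norm_real,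
          Complex.norm_real, Complex.norm_real]
        simp only [norm_one, Real.norm_eq_abs]
        ring
    _ ≤ B / (c * t) ^ 2 * ‖z‖ + ‖z‖ ^ 2 / (c * t) ^ 2 + 1 := by gcongr
    _ ≤ _ := Real.add_one_le_exp _

lemma aux_summable : Summable (fun k : ℕ => √((k : ℝ) + 1) / ((k : ℝ) + 1) ^ 2) := by
  have h : Summable (fun n : ℕ => (n : ℝ) ^ (-(3 / 2) : ℝ)) :=
    Real.summable_nat_rpow.2 (by norm_num)
  have h' := (summable_nat_add_iff 1).2 h
  refine h'.congr fun k => ?_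
  have : (0 : ℝ) < (k : ℝ) + 1 := by positivity
  push_cast
  rw [Real.sqrt_eq_rpow, ← Real.rpow_natCast, ← Real.rpow_sub this]
  norm_num

lemma aux_head (s : Finset ℕ) (N : ℕ) :
    ∑ k ∈ s with k < N, 1 / ((k : ℝ) + 1) ≤ 1 + Real.log N := by
  calc ∑ k ∈ s with k < N, 1 / ((k : ℝ) + 1) ≤ ∑ k ∈ Finset.range N, 1 / ((k : ℝ) + 1) := by
        apply Finset.sum_le_sum_of_subset_of_nonneg
        · intro k hk
          simpa using (Finset.mem_filter.1 hk).2
        · intros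
          positivity
    _ = (harmonic N : ℝ) := by simp [harmonic]
    _ ≤ _ := harmonic_le_one_add_log N

lemma aux_tail (s : Finset ℕ) (N : ℕ) (hN : N ≠ 0) :
    ∑ k ∈ s with ¬ k < N, 1 / ((k : ℝ) + 1) ^ 2 ≤ 1 / (N : ℝ) := by
  obtain ⟨n, hn⟩ := s.exists_nat_subset_range
  have hsub : (s.filter (fun k => ¬ k < N)).image (fun x : ℕ => x + 1) ⊆ Finset.Ioc N (max N n) := by
    intro j hj
    simp only [Finset.mem_image, Finset.mem_filter] at hj
    obtain ⟨k, ⟨hk, hkN⟩, rfl⟩ := hj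
    have := Finset.mem_range.1 (hn hk)
    rw [Finset.mem_Ioc]
    omega
  calc ∑ k ∈ s with ¬ k < N, 1 / ((k : ℝ) + 1) ^ 2
      = ∑ j ∈ (s.filter (fun k => ¬ k < N)).image (fun x : ℕ => x + 1), (((j : ℕ) : ℝ) ^ 2)⁻¹ := by
        rw [Finset.sum_image (by intro a _ b _ h; simpa using h)]
        simp
    _ ≤ ∑ j ∈ Finset.Ioc N (max N n), ((j : ℝ) ^ 2)⁻¹ :=
        Finset.sum_le_sum_of_subset_of_nonneg hsub (by intros; positivity)
    _ ≤ (N : ℝ)⁻¹ - ((max N n : ℕ) : ℝ)⁻¹ := sum_Ioc_inv_sq_le_sub hN (le_max_left _ _)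
    _ ≤ _ := by
        have : 0 ≤ ((max N n : ℕ) : ℝ)⁻¹ := by positivity
        rw [one_div]
        linarith

lemma aux_tprod (f : ℕ → ℂ) (B : ℝ) (h1 : 1 ≤ B) (h : ∀ s : Finset ℕ, ‖∏ k ∈ s, f k‖ ≤ B) :
    ‖∏' k, f k‖ ≤ B := by
  by_cases hf : Multipliable f
  · exact le_of_tendsto hf.hasProd.norm (Filter.Eventually.of_forall fun s => by
      simpa [norm_prod] using h s)
  · rw [tprod_eq_one_of_not_multipliable hf]
    simpa using h1

theorem xi_growth_upper_bound (y : ℤ → ℝ) (hy0 : ∀ k, y k ≠ 0)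
    (M : ℝ) (hM : 0 < M)
    (hbound : ∀ k : ℤ, |y k - k| ≤ M * Real.log (2 + |(k : ℝ)|))
    (ξ : ℂ → ℂ)
    (hξ : ∀ z : ℂ, ξ z = Complex.exp (Complex.I * π * z) * (1 - z / (y 0 : ℂ)) *
      ∏' k : ℕ, (1 - z / (y ((k : ℤ) + 1) : ℂ)) * (1 - z / (y (-((k : ℤ) + 1)) : ℂ))) :
    ∃ C : ℝ, 0 < C ∧ ∀ z : ℂ,
      ‖ξ z‖ ≤ Real.exp (C * ‖z‖ * Real.log (2 + ‖z‖)) := by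
  obtain ⟨c, hc, hlow⟩ := aux_lower y hy0 M hM hbound
  set S := ∑' k : ℕ, √((k : ℝ) + 1) / ((k : ℝ) + 1) ^ 2 with hS
  have hS0 : 0 ≤ S := tsum_nonneg fun k => by positivity
  have hy00 : 0 < |y 0| := abs_pos.2 (hy0 0)
  have hlow1 : ∀ k : ℕ, c * ((k : ℝ) + 1) ≤ |y ((k : ℤ) + 1)| := fun k => by
    have := hlow ((k : ℤ) + 1)
    push_cast at this
    rwa [abs_of_pos (by positivity : (0 : ℝ) < (k : ℝ) + 1)] at this
  have hlow2 : ∀ k : ℕ, c * ((k : ℝ) + 1) ≤ |y (-((k : ℤ) + 1))| := fun k => by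
    have := hlow (-((k : ℤ) + 1))
    push_cast at this
    rwa [abs_neg,
      abs_of_pos (by positivity : (0 : ℝ) < (k : ℝ) + 1)] at this
  have hsum : ∀ k : ℕ, |y ((k : ℤ) + 1) + y (-((k : ℤ) + 1))| ≤ 8 * M * √((k : ℝ) + 1) := by
    intro k
    have hk : (0 : ℝ) < (k : ℝ) + 1 := by positivity
    have h1 := hbound ((k : ℤ) + 1)
    have h2 := hbound (-((k : ℤ) + 1))
    rw [Int.cast_neg, abs_neg] at h2
    push_cast at h1 h2
    rw [abs_of_pos hk] at h1 h2
    have h3 := aux_log_le ((k : ℝ) + 1) (by linarith [(Nat.cast_nonneg k : (0 : ℝ) ≤ k)])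
    have h4 : M * Real.log (2 + ((k : ℝ) + 1)) ≤ M * (4 * √((k : ℝ) + 1)) := by gcongr
    rw [abs_le] at h1 h2 ⊢
    constructor <;> linarith [h1.1, h1.2, h2.1, h2.2]
  refine ⟨2 * (π + 1 / |y 0| + 8 * M / c ^ 2 * S + 2 / c + 1 / c ^ 2) + 2 / c,
    by positivity, fun z => ?_⟩
  set r := ‖z‖ with hr
  have hr0 : 0 ≤ r := norm_nonneg z
  set N := ⌊r⌋₊ + 1 with hN
  have hN0 : N ≠ 0 := by omega
  have hrN : r ≤ N := by
    rw [hN]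
    push_cast
    exact (Nat.lt_floor_add_one r).le
  have hNr : (N : ℝ) ≤ 2 + r := by
    rw [hN]
    push_cast
    linarith [Nat.floor_le hr0]
  have hNpos : (0 : ℝ) < N := by positivity
  set L := Real.log (2 + r) with hL
  have hL1 : 1 ≤ 2 * L := by
    have : Real.log 2 ≤ L := Real.log_le_log (by norm_num) (by linarith)
    linarith [Real.log_two_gt_d9]
  have hlogN : Real.log N ≤ L := Real.log_le_log hNpos hNr
  set E := 8 * M / c ^ 2 * S * r + 2 / c * r * (1 + L) + 1 / c ^ 2 * r with hE
  have hE0 : 0 ≤ E := by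
    have : 0 ≤ L := by linarith
    positivity
  have hprod : ‖∏' k : ℕ, (1 - z / (y ((k : ℤ) + 1) : ℂ)) * (1 - z / (y (-((k : ℤ) + 1)) : ℂ))‖
      ≤ Real.exp E := by
    apply aux_tprod _ _ (Real.one_le_exp hE0)
    intro s
    have hfac : ∀ k : ℕ, ‖(1 - z / (y ((k : ℤ) + 1) : ℂ)) * (1 - z / (y (-((k : ℤ) + 1)) : ℂ))‖ ≤
        Real.exp (8 * M / c ^ 2 * r * (√((k : ℝ) + 1) / ((k : ℝ) + 1) ^ 2) +
          (if k < N then 2 / c * r * (1 / ((k : ℝ) + 1))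
            else 1 / c ^ 2 * r ^ 2 * (1 / ((k : ℝ) + 1) ^ 2))) := by
      intro k
      have hk : (0 : ℝ) < (k : ℝ) + 1 := by positivity
      split_ifs with hkN
      · rw [norm_mul]
        calc _ ≤ Real.exp (r / (c * ((k : ℝ) + 1))) * Real.exp (r / (c * ((k : ℝ) + 1))) := by
              gcongr
              · exact aux_factor _ _ _ hc hk (hlow1 k) z
              · exact aux_factor _ _ _ hc hk (hlow2 k) z
          _ = Real.exp (2 / c * r * (1 / ((k : ℝ) + 1))) := by
              rw [← Real.exp_add]
              congr 1
              field_simp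
              ring
          _ ≤ _ := by
              apply Real.exp_le_exp.2
              have : 0 ≤ 8 * M / c ^ 2 * r * (√((k : ℝ) + 1) / ((k : ℝ) + 1) ^ 2) := by positivity
              linarith
      · refine (aux_pair _ _ _ _ _ hc hk (hlow1 k) (hlow2 k) (hsum k) z).trans (le_of_eq ?_)
        congr 1
        rw [← hr]
        field_simp
    rw [norm_prod]
    refine (Finset.prod_le_prod (fun _ _ => norm_nonneg _) (fun k _ => hfac k)).trans ?_
    rw [← Real.exp_sum]
    apply Real.exp_le_exp.2
    rw [Finset.sum_add_distrib, Finset.sum_ite, ← Finset.mul_sum, ← Finset.mul_sum,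
      ← Finset.mul_sum]
    have h1 : ∑ k ∈ s, √((k : ℝ) + 1) / ((k : ℝ) + 1) ^ 2 ≤ S :=
      aux_summable.sum_le_tsum s (fun k _ => by positivity)
    have h2 := (aux_head s N).trans (by linarith : 1 + Real.log N ≤ 1 + L)
    have h3 := aux_tail s N hN0
    have h4 : r ^ 2 * (1 / (N : ℝ)) ≤ r := by
      rw [mul_one_div, div_le_iff₀ hNpos]
      nlinarith
    have a1 := mul_le_mul_of_nonneg_left h1 (by positivity : 0 ≤ 8 * M / c ^ 2 * r)
    have a2 := mul_le_mul_of_nonneg_left h2 (by positivity : 0 ≤ 2 / c * r)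
    have a3 := mul_le_mul_of_nonneg_left h3 (by positivity : 0 ≤ 1 / c ^ 2 * r ^ 2)
    have a4 := mul_le_mul_of_nonneg_left h4 (by positivity : 0 ≤ 1 / c ^ 2)
    rw [hE]
    linarith
  have hexp : ‖Complex.exp (Complex.I * π * z)‖ ≤ Real.exp (π * r) := by
    rw [Complex.norm_exp]
    apply Real.exp_le_exp.2
    refine (Complex.re_le_norm _).trans (le_of_eq ?_)
    rw [norm_mul, norm_mul, Complex.norm_I, Complex.norm_real, Real.norm_eq_abs,
      abs_of_pos Real.pi_pos, one_mul]
  have h0 : ‖1 - z / (y 0 : ℂ)‖ ≤ Real.exp (r / (|y 0| * 1)) :=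
    aux_factor (y 0) |y 0| 1 hy00 one_pos (by simp) z
  rw [hξ, norm_mul, norm_mul]
  calc _ ≤ Real.exp (π * r) * Real.exp (r / (|y 0| * 1)) * Real.exp E := by gcongr
    _ = Real.exp (π * r + r / (|y 0| * 1) + E) := by rw [← Real.exp_add, ← Real.exp_add]
    _ ≤ _ := by
      apply Real.exp_le_exp.2
      have hq : 0 ≤ (π + 1 / |y 0| + 8 * M / c ^ 2 * S + 2 / c + 1 / c ^ 2) * r := by positivity
      have := mul_le_mul_of_nonneg_left hL1 hq
      have e : r / (|y 0| * 1) = 1 / |y 0| * r := by rw [mul_one]; ring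
      rw [e, hE]
      linarith
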